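/- arXiv:2503.10313 — 2 statements merged into one kernel-verified Lean document; each statement's English description precedes it below -/
import Mathlib

section
/- Let A be a skew left brace and let γ_n(A,∘) denote the n-th term of the lower central series of the group (A,∘). Then for every n ≥ 1, γ_n(A,∘) is contained in Γ_n(A). -/
set_option linter.unusedVariables false

universe u v

/-- A skew left brace: a carrier with two group structures `(A,·)` (written `dmul`) and
`(A,∘)` (written `cmul`) sharing the same identity `ident`, satisfying
`a ∘ (b · c) = (a ∘ b) · a⁻¹ · (a ∘ c)`. -/
class SkewBrace (A : Type u) where
  dmul : A → A → A
  ident : A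
  dinv : A → A
  cmul : A → A → A
  cinv : A → A
  dmul_assoc : ∀ a b c : A, dmul (dmul a b) c = dmul a (dmul b c)
  ident_dmul : ∀ a : A, dmul ident a = a
  dmul_ident : ∀ a : A, dmul a ident = a
  dinv_dmul : ∀ a : A, dmul (dinv a) a = ident
  dmul_dinv : ∀ a : A, dmul a (dinv a) = ident
  cmul_assoc : ∀ a b c : A, cmul (cmul a b) c = cmul a (cmul b c)
  ident_cmul : ∀ a : A, cmul ident a = a
  cmul_ident : ∀ a : A, cmul a ident = a
  cinv_cmul : ∀ a : A, cmul (cinv a) a = ident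
  cmul_cinv : ∀ a : A, cmul a (cinv a) = ident
  compat : ∀ a b c : A, cmul a (dmul b c) = dmul (dmul (cmul a b) (dinv a)) (cmul a c)

namespace SkewBrace

variable {A : Type u} [SkewBrace A]

/-- The lambda map `λ_a(b) = a⁻¹ · (a ∘ b)`. -/
def lam (a b : A) : A := dmul (dinv a) (cmul a b)

/-- The star operation `a * b = λ_a(b) · b⁻¹`. -/
def bstar (a b : A) : A := dmul (lam a b) (dinv b)

/-- The dot commutator `[a,b]· = a · b · a⁻¹ · b⁻¹`. -/
def dcomm (a b : A) : A := dmul (dmul (dmul a b) (dinv a)) (dinv b)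

/-- The circle commutator `[a,b]∘ = a ∘ b ∘ ā ∘ b̄`. -/
def ccomm (a b : A) : A := cmul (cmul (cmul a b) (cinv a)) (cinv b)

/-- Membership in the subgroup of `(A,·)` generated by a subset. -/
inductive dclosure (S : Set A) : A → Prop
  | mem {x : A} : x ∈ S → dclosure S x
  | one : dclosure S ident
  | mul {x y : A} : dclosure S x → dclosure S y → dclosure S (dmul x y)
  | inv {x : A} : dclosure S x → dclosure S (dinv x)

/-- The subgroup of `(A,·)` generated by a subset, as a set. -/
def dcl (S : Set A) : Set A := {x | dclosure S x}

/-- Membership in the subgroup of `(A,∘)` generated by a subset. -/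
inductive cclosure (S : Set A) : A → Prop
  | mem {x : A} : x ∈ S → cclosure S x
  | one : cclosure S ident
  | mul {x y : A} : cclosure S x → cclosure S y → cclosure S (cmul x y)
  | inv {x : A} : cclosure S x → cclosure S (cinv x)

/-- The subgroup of `(A,∘)` generated by a subset, as a set. -/
def ccl (S : Set A) : Set A := {x | cclosure S x}

/-- The set `{x * y : x ∈ I, y ∈ J}` (star values). -/
def starSet (I J : Set A) : Set A := {x | ∃ a ∈ I, ∃ b ∈ J, x = bstar a b}

/-- The set of dot commutators `[a,b]·` with `a ∈ I`, `b ∈ J`. -/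
def dcommSet (I J : Set A) : Set A := {x | ∃ a ∈ I, ∃ b ∈ J, x = dcomm a b}

/-- The set of circle commutators `[a,b]∘` with `a ∈ I`, `b ∈ J`. -/
def ccommSet (I J : Set A) : Set A := {x | ∃ a ∈ I, ∃ b ∈ J, x = ccomm a b}

/-- The lower central series `Γ_n(A)` of the skew brace `A` (`Gamma A n = Γ_n(A)` for `n ≥ 1`):
`Γ₁(A) = A` and `Γ_n(A) = ⟨A * Γ_{n-1}(A), Γ_{n-1}(A) * A, [A,Γ_{n-1}(A)]·⟩·`. -/
def Gamma (A : Type u) [SkewBrace A] : ℕ → Set A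
  | 0 => Set.univ
  | 1 => Set.univ
  | (n+2) =>
      dcl (starSet Set.univ (Gamma A (n+1)) ∪ starSet (Gamma A (n+1)) Set.univ ∪
        dcommSet Set.univ (Gamma A (n+1)))

/-- The lower central series `γ_n(A,∘)` of the group `(A,∘)`
(`gammaCirc A n = γ_n(A,∘)` for `n ≥ 1`). -/
def gammaCirc (A : Type u) [SkewBrace A] : ℕ → Set A
  | 0 => Set.univ
  | 1 => Set.univ
  | (n+2) => ccl (ccommSet (gammaCirc A (n+1)) Set.univ)

/-- The series `Γ̄_n(A)`: `Γ̄₁(A) = A`, `Γ̄_n(A) = ⟨A * Γ̄_{n-1}(A), [A, Γ̄_{n-1}(A)]·⟩·`. -/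
def GammaBar (A : Type u) [SkewBrace A] : ℕ → Set A
  | 0 => Set.univ
  | 1 => Set.univ
  | (n+2) =>
      dcl (starSet Set.univ (GammaBar A (n+1)) ∪ dcommSet Set.univ (GammaBar A (n+1)))

/-- The annihilator series: `AnnS A n = Ann_n(A)`, with `Ann_0(A) = 1` and
`Ann_n(A) = {a | a*b, b*a, [a,b]· ∈ Ann_{n-1}(A) for all b}`. -/
def AnnS (A : Type u) [SkewBrace A] : ℕ → Set A
  | 0 => {ident}
  | (n+1) => {a | ∀ b : A, bstar a b ∈ AnnS A n ∧ bstar b a ∈ AnnS A n ∧ dcomm a b ∈ AnnS A n}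

/-- The alphabet `X = {γ·, γ̄·, *, *̄}` of brace commutator symbols. -/
inductive BWord : Type
  | g | gbar | s | sbar

/-- Evaluation of a single symbol of `X`. -/
def evalX : BWord → A → A → A
  | BWord.g => dcomm
  | BWord.gbar => fun a b => dcomm b a
  | BWord.s => bstar
  | BWord.sbar => fun a b => bstar b a

/-- `evalW e a n` is the value `m(a₀ a₁ ⋯ a_n)` of the degree-`n` brace commutator word
`m = (e 0)(e 1)⋯(e (n-1))` on the arguments `a 0, …, a n`:
`m(a₀ ⋯ a_n) = (e 0)(a₀, (e 1)(a₁, …, (e (n-1))(a_{n-1}, a_n)⋯))`. -/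
def evalW : (ℕ → BWord) → (ℕ → A) → ℕ → A
  | _, a, 0 => a 0
  | e, a, (n+1) => evalX (e 0) (a 0) (evalW (fun i => e (i+1)) (fun i => a (i+1)) n)

/-- `Asub A t = A_{(t)}`, the subgroup of `(A,·)` generated by all values of brace commutator
words of degree `≥ t`. -/
def Asub (A : Type u) [SkewBrace A] (t : ℕ) : Set A :=
  dcl {x | ∃ s : ℕ, t ≤ s ∧ ∃ (e : ℕ → BWord) (a : ℕ → A), x = evalW e a s}

/-- `Sset A r = S_r(A)`, the set of all values of brace commutator words of degree exactly `r`
(`S_0(A) = A`). -/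
def Sset (A : Type u) [SkewBrace A] (r : ℕ) : Set A :=
  {x | ∃ (e : ℕ → BWord) (a : ℕ → A), x = evalW e a r}

/-- `cosetRel I a b` says that `b` lies in the coset `I · a`. -/
def cosetRel (I : Set A) (a b : A) : Prop := ∃ c ∈ I, b = dmul c a

/-- The class `I_n`: the maps `φ_m : (A/Ann_n(A))^{n+1} → A_{(n)}`,
`(Ann_n(A)a₁, …, Ann_n(A)a_{n+1}) ↦ m(a₁⋯a_{n+1})`, are well defined for every word `m` of
degree `n`. -/
def InClass (A : Type u) [SkewBrace A] (n : ℕ) : Prop :=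
  ∀ (e : ℕ → BWord) (a b : ℕ → A),
    (∀ i : ℕ, i ≤ n → cosetRel (AnnS A n) (a i) (b i)) →
    evalW e b n = evalW e a n

/-- A skew left brace `(A,·,∘)` is symmetric if `(A,∘,·)` is also a skew left brace, i.e.
`a · (b ∘ c) = (a · b) ∘ ā ∘ (a · c)`. -/
def IsSymmetric (A : Type u) [SkewBrace A] : Prop :=
  ∀ a b c : A, dmul a (cmul b c) = cmul (cmul (dmul a b) (cinv a)) (dmul a c)

/-- A sub-skew brace: a subset which is a subgroup of both `(A,·)` and `(A,∘)`. -/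
structure IsSubBrace (A : Type u) [SkewBrace A] (S : Set A) : Prop where
  ident_mem : ident ∈ S
  dmul_mem : ∀ {x y : A}, x ∈ S → y ∈ S → dmul x y ∈ S
  dinv_mem : ∀ {x : A}, x ∈ S → dinv x ∈ S
  cmul_mem : ∀ {x y : A}, x ∈ S → y ∈ S → cmul x y ∈ S
  cinv_mem : ∀ {x : A}, x ∈ S → cinv x ∈ S

/-- An ideal of a skew brace: a subgroup of `(A,·)`, normal in `(A,·)` and `(A,∘)`,
and invariant under all `λ_a`. -/
structure IsIdeal (A : Type u) [SkewBrace A] (I : Set A) : Prop where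
  ident_mem : ident ∈ I
  dmul_mem : ∀ {x y : A}, x ∈ I → y ∈ I → dmul x y ∈ I
  dinv_mem : ∀ {x : A}, x ∈ I → dinv x ∈ I
  dconj_mem : ∀ (a : A) {x : A}, x ∈ I → dmul (dmul a x) (dinv a) ∈ I
  cconj_mem : ∀ (a : A) {x : A}, x ∈ I → cmul (cmul a x) (cinv a) ∈ I
  lam_mem : ∀ (a : A) {x : A}, x ∈ I → lam a x ∈ I

/-- A homomorphism of skew braces. -/
structure IsBraceHom {A : Type u} {B : Type v} [SkewBrace A] [SkewBrace B] (f : A → B) : Prop where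
  map_dmul : ∀ x y : A, f (dmul x y) = dmul (f x) (f y)
  map_cmul : ∀ x y : A, f (cmul x y) = cmul (f x) (f y)

/-- The data of an isoclinism of skew braces along ideals `I` of `A` and `J` of `B`:
`ξ` induces a brace isomorphism `A/I → B/J` and `θ` restricts to a brace isomorphism
`Γ₂(A) → Γ₂(B)` compatible with the commutator and star maps. -/
structure IsoclinismData (A : Type u) (B : Type v) [SkewBrace A] [SkewBrace B]
    (I : Set A) (J : Set B) (ξ θ : A → B) : Prop where
  xi_resp : ∀ a a' : A, cosetRel I a a' ↔ cosetRel J (ξ a) (ξ a')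
  xi_surj : ∀ b : B, ∃ a : A, cosetRel J b (ξ a)
  xi_dmul : ∀ a a' : A, cosetRel J (dmul (ξ a) (ξ a')) (ξ (dmul a a'))
  xi_cmul : ∀ a a' : A, cosetRel J (cmul (ξ a) (ξ a')) (ξ (cmul a a'))
  theta_maps : ∀ x ∈ Gamma A 2, θ x ∈ Gamma B 2
  theta_inj : ∀ x ∈ Gamma A 2, ∀ y ∈ Gamma A 2, θ x = θ y → x = y
  theta_surj : ∀ y ∈ Gamma B 2, ∃ x ∈ Gamma A 2, θ x = y
  theta_dmul : ∀ x ∈ Gamma A 2, ∀ y ∈ Gamma A 2, θ (dmul x y) = dmul (θ x) (θ y)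
  theta_cmul : ∀ x ∈ Gamma A 2, ∀ y ∈ Gamma A 2, θ (cmul x y) = cmul (θ x) (θ y)
  compat_dcomm : ∀ a₁ a₂ : A, ∀ b₁ b₂ : B, cosetRel J b₁ (ξ a₁) → cosetRel J b₂ (ξ a₂) →
    θ (dcomm a₁ a₂) = dcomm b₁ b₂
  compat_star : ∀ a₁ a₂ : A, ∀ b₁ b₂ : B, cosetRel J b₁ (ξ a₁) → cosetRel J b₂ (ξ a₂) →
    θ (bstar a₁ a₂) = bstar b₁ b₂

/-- Isoclinism (1-isoclinism) of skew left braces. -/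
def Isoclinic (A : Type u) (B : Type v) [SkewBrace A] [SkewBrace B] : Prop :=
  ∃ ξ θ : A → B, IsoclinismData A B (AnnS A 1) (AnnS B 1) ξ θ

/-- The data of an `n`-isoclinism of skew braces: `ξ` induces a brace isomorphism
`A/Ann_n(A) → B/Ann_n(B)` and `θ` restricts to a brace isomorphism `A_{(n)} → B_{(n)}`
commuting with all brace commutator word maps of degree `n`. -/
structure IsoclinismDataN (A : Type u) (B : Type v) [SkewBrace A] [SkewBrace B]
    (n : ℕ) (ξ θ : A → B) : Prop where
  xi_resp : ∀ a a' : A, cosetRel (AnnS A n) a a' ↔ cosetRel (AnnS B n) (ξ a) (ξ a')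
  xi_surj : ∀ b : B, ∃ a : A, cosetRel (AnnS B n) b (ξ a)
  xi_dmul : ∀ a a' : A, cosetRel (AnnS B n) (dmul (ξ a) (ξ a')) (ξ (dmul a a'))
  xi_cmul : ∀ a a' : A, cosetRel (AnnS B n) (cmul (ξ a) (ξ a')) (ξ (cmul a a'))
  theta_maps : ∀ x ∈ Asub A n, θ x ∈ Asub B n
  theta_inj : ∀ x ∈ Asub A n, ∀ y ∈ Asub A n, θ x = θ y → x = y
  theta_surj : ∀ y ∈ Asub B n, ∃ x ∈ Asub A n, θ x = y
  theta_dmul : ∀ x ∈ Asub A n, ∀ y ∈ Asub A n, θ (dmul x y) = dmul (θ x) (θ y)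
  theta_cmul : ∀ x ∈ Asub A n, ∀ y ∈ Asub A n, θ (cmul x y) = cmul (θ x) (θ y)
  compat : ∀ (e : ℕ → BWord) (a : ℕ → A) (b : ℕ → B),
    (∀ i : ℕ, i ≤ n → cosetRel (AnnS B n) (b i) (ξ (a i))) →
    θ (evalW e a n) = evalW e b n

/-- `n`-isoclinism of skew left braces. -/
def IsoclinicN (A : Type u) (B : Type v) [SkewBrace A] [SkewBrace B] (n : ℕ) : Prop :=
  ∃ ξ θ : A → B, IsoclinismDataN A B n ξ θ

/-- The product set `S · T = {s · t : s ∈ S, t ∈ T}` in `(A,·)`. -/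
def setDProd (S T : Set A) : Set A := {x | ∃ s ∈ S, ∃ t ∈ T, x = dmul s t}

/-- The product set `S ∘ T = {s ∘ t : s ∈ S, t ∈ T}` in `(A,∘)`. -/
def setCProd (S T : Set A) : Set A := {x | ∃ s ∈ S, ∃ t ∈ T, x = cmul s t}

/-- The skew brace structure on a sub-skew brace. -/
def subBrace (S : Set A) (h : IsSubBrace A S) : SkewBrace S where
  dmul x y := ⟨dmul x.1 y.1, h.dmul_mem x.2 y.2⟩
  ident := ⟨ident, h.ident_mem⟩
  dinv x := ⟨dinv x.1, h.dinv_mem x.2⟩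
  cmul x y := ⟨cmul x.1 y.1, h.cmul_mem x.2 y.2⟩
  cinv x := ⟨cinv x.1, h.cinv_mem x.2⟩
  dmul_assoc a b c := Subtype.ext (dmul_assoc a.1 b.1 c.1)
  ident_dmul a := Subtype.ext (ident_dmul a.1)
  dmul_ident a := Subtype.ext (dmul_ident a.1)
  dinv_dmul a := Subtype.ext (dinv_dmul a.1)
  dmul_dinv a := Subtype.ext (dmul_dinv a.1)
  cmul_assoc a b c := Subtype.ext (cmul_assoc a.1 b.1 c.1)
  ident_cmul a := Subtype.ext (ident_cmul a.1)
  cmul_ident a := Subtype.ext (cmul_ident a.1)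
  cinv_cmul a := Subtype.ext (cinv_cmul a.1)
  cmul_cinv a := Subtype.ext (cmul_cinv a.1)
  compat a b c := Subtype.ext (compat a.1 b.1 c.1)

/-- The direct product of two skew braces, with componentwise operations. -/
instance prodBrace (A : Type u) (B : Type v) [SkewBrace A] [SkewBrace B] :
    SkewBrace (A × B) where
  dmul p q := (dmul p.1 q.1, dmul p.2 q.2)
  ident := (ident, ident)
  dinv p := (dinv p.1, dinv p.2)
  cmul p q := (cmul p.1 q.1, cmul p.2 q.2)
  cinv p := (cinv p.1, cinv p.2)
  dmul_assoc a b c := Prod.ext_iff.mpr ⟨dmul_assoc _ _ _, dmul_assoc _ _ _⟩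
  ident_dmul a := Prod.ext_iff.mpr ⟨ident_dmul _, ident_dmul _⟩
  dmul_ident a := Prod.ext_iff.mpr ⟨dmul_ident _, dmul_ident _⟩
  dinv_dmul a := Prod.ext_iff.mpr ⟨dinv_dmul _, dinv_dmul _⟩
  dmul_dinv a := Prod.ext_iff.mpr ⟨dmul_dinv _, dmul_dinv _⟩
  cmul_assoc a b c := Prod.ext_iff.mpr ⟨cmul_assoc _ _ _, cmul_assoc _ _ _⟩
  ident_cmul a := Prod.ext_iff.mpr ⟨ident_cmul _, ident_cmul _⟩
  cmul_ident a := Prod.ext_iff.mpr ⟨cmul_ident _, cmul_ident _⟩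
  cinv_cmul a := Prod.ext_iff.mpr ⟨cinv_cmul _, cinv_cmul _⟩
  cmul_cinv a := Prod.ext_iff.mpr ⟨cmul_cinv _, cmul_cinv _⟩
  compat a b c := Prod.ext_iff.mpr ⟨compat _ _ _, compat _ _ _⟩

end SkewBrace

namespace SkewBrace

/-- The group `(A,·)`. -/
abbrev dotGroup (A : Type u) [SkewBrace A] : Group A where
  mul := dmul
  one := ident
  inv := dinv
  mul_assoc := dmul_assoc
  one_mul := ident_dmul
  mul_one := dmul_ident
  inv_mul_cancel := dinv_dmul

/-- The group `(A,∘)`. -/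
abbrev circGroup (A : Type u) [SkewBrace A] : Group A where
  mul := cmul
  one := ident
  inv := cinv
  mul_assoc := cmul_assoc
  one_mul := ident_cmul
  mul_one := cmul_ident
  inv_mul_cancel := cinv_cmul

section

variable {A : Type u} [SkewBrace A]

theorem dinv_dmul_cancel_left (a b : A) : dmul (dinv a) (dmul a b) = b :=
  letI := dotGroup A; inv_mul_cancel_left a b

theorem dmul_dinv_cancel_left (a b : A) : dmul a (dmul (dinv a) b) = b :=
  letI := dotGroup A; mul_inv_cancel_left a b

theorem dinv_dmul_rev (a b : A) : dinv (dmul a b) = dmul (dinv b) (dinv a) :=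
  letI := dotGroup A; mul_inv_rev a b

theorem dinv_dinv (a : A) : dinv (dinv a) = a :=
  letI := dotGroup A; inv_inv a

theorem eq_dmul_dinv_of_dmul_eq {a b c : A} (h : dmul a b = c) : a = dmul c (dinv b) :=
  letI := dotGroup A; eq_mul_inv_of_mul_eq h

theorem dinv_eq_of_dmul_eq_ident {a b : A} (h : dmul a b = ident) : dinv b = a :=
  letI := dotGroup A; inv_eq_of_mul_eq_one_left h

theorem cmul_conj_cmul (a x : A) : cmul (cmul (cmul a x) (cinv a)) a = cmul a x :=
  letI := circGroup A; inv_mul_cancel_right (a * x) a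

theorem cmul_cinv_conj (a x : A) :
    cmul a (cmul (cmul (cinv a) x) (cinv (cinv a))) = cmul x a := by
  let := circGroup A
  change a * (a⁻¹ * x * a⁻¹⁻¹) = x * a
  group

theorem ccomm_cmul (x a : A) : cmul (ccomm x a) (cmul a x) = cmul x a := by
  let := circGroup A
  change x * a * x⁻¹ * a⁻¹ * (a * x) = x * a
  group

theorem ccomm_eq_cmul_conj (x a : A) :
    ccomm x a = cmul x (cmul (cmul a (cinv x)) (cinv a)) := by
  simp only [ccomm, cmul_assoc]

theorem dcomm_swap (x a : A) : dcomm x a = dinv (dcomm a x) := by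
  simp only [dcomm, dinv_dmul_rev, dinv_dinv, dmul_assoc]

theorem cmul_eq_dmul_lam (a b : A) : cmul a b = dmul a (lam a b) :=
  (dmul_dinv_cancel_left a (cmul a b)).symm

theorem lam_eq_bstar_dmul (a b : A) : lam a b = dmul (bstar a b) b := by
  simp only [bstar, dmul_assoc, dinv_dmul, dmul_ident]

theorem cmul_eq_dmul_bstar (a b : A) : cmul a b = dmul a (dmul (bstar a b) b) := by
  rw [cmul_eq_dmul_lam, lam_eq_bstar_dmul]

theorem dconj_eq_dcomm_dmul (a x : A) :
    dmul (dmul a x) (dinv a) = dmul (dcomm a x) x := by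
  simp only [dcomm, dmul_assoc, dinv_dmul, dmul_ident]

namespace IsIdeal

variable {I : Set A}

theorem cmul_mem (hI : IsIdeal A I) {x y : A} (hx : x ∈ I) (hy : y ∈ I) : cmul x y ∈ I := by
  rw [cmul_eq_dmul_lam]
  exact hI.dmul_mem hx (hI.lam_mem x hy)

theorem cinv_mem (hI : IsIdeal A I) {x : A} (hx : x ∈ I) : cinv x ∈ I := by
  have h : dmul (cinv x) (lam (cinv x) x) = ident := by
    rw [← cmul_eq_dmul_lam, cinv_cmul]
  rw [← dinv_eq_of_dmul_eq_ident h]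
  exact hI.dinv_mem (hI.lam_mem _ hx)

theorem bstar_mem_right (hI : IsIdeal A I) (a : A) {x : A} (hx : x ∈ I) : bstar a x ∈ I :=
  hI.dmul_mem (hI.lam_mem a hx) (hI.dinv_mem hx)

theorem bstar_mem_left (hI : IsIdeal A I) {x : A} (hx : x ∈ I) (a : A) : bstar x a ∈ I := by
  have h : bstar x a = dmul (dinv x) (dmul (dmul a
      (lam a (cmul (cmul (cinv a) x) (cinv (cinv a))))) (dinv a)) := by
    rw [← cmul_eq_dmul_lam, cmul_cinv_conj, bstar, lam, dmul_assoc]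
  rw [h]
  exact hI.dmul_mem (hI.dinv_mem hx) (hI.dconj_mem a (hI.lam_mem a (hI.cconj_mem _ hx)))

theorem dcomm_mem (hI : IsIdeal A I) (a : A) {x : A} (hx : x ∈ I) : dcomm a x ∈ I :=
  hI.dmul_mem (hI.dconj_mem a hx) (hI.dinv_mem hx)

theorem ccomm_mem (hI : IsIdeal A I) {x : A} (hx : x ∈ I) (a : A) : ccomm x a ∈ I := by
  rw [ccomm_eq_cmul_conj]
  exact hI.cmul_mem hx (hI.cconj_mem a (hI.cinv_mem hx))

theorem ccl_subset (hI : IsIdeal A I) {S : Set A} (hS : S ⊆ I) : ccl S ⊆ I := by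
  intro x hx
  induction hx with
  | mem h => exact hS h
  | one => exact hI.ident_mem
  | mul _ _ hx hy => exact hI.cmul_mem hx hy
  | inv _ hx => exact hI.cinv_mem hx

theorem dcl_subset (hI : IsIdeal A I) {S : Set A} (hS : S ⊆ I) : dcl S ⊆ I := by
  intro x hx
  induction hx with
  | mem h => exact hS h
  | one => exact hI.ident_mem
  | mul _ _ hx hy => exact hI.dmul_mem hx hy
  | inv _ hx => exact hI.dinv_mem hx

end IsIdeal

theorem isIdeal_univ : IsIdeal A (Set.univ : Set A) := by
  constructor <;> intros <;> trivial

theorem bstar_mem_Gamma_right {n : ℕ} (a : A) {x : A} (hx : x ∈ Gamma A (n + 1)) :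
    bstar a x ∈ Gamma A (n + 2) :=
  .mem (.inl (.inl ⟨a, trivial, x, hx, rfl⟩))

theorem bstar_mem_Gamma_left {n : ℕ} {x : A} (hx : x ∈ Gamma A (n + 1)) (a : A) :
    bstar x a ∈ Gamma A (n + 2) :=
  .mem (.inl (.inr ⟨x, hx, a, trivial, rfl⟩))

theorem dcomm_mem_Gamma {n : ℕ} (a : A) {x : A} (hx : x ∈ Gamma A (n + 1)) :
    dcomm a x ∈ Gamma A (n + 2) :=
  .mem (.inr ⟨a, trivial, x, hx, rfl⟩)

theorem Gamma_succ_subset {n : ℕ} (hI : IsIdeal A (Gamma A (n + 1))) :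
    Gamma A (n + 2) ⊆ Gamma A (n + 1) := by
  refine hI.dcl_subset ?_
  rintro _ ((⟨a, -, x, hx, rfl⟩ | ⟨x, hx, a, -, rfl⟩) | ⟨a, -, x, hx, rfl⟩)
  · exact hI.bstar_mem_right a hx
  · exact hI.bstar_mem_left hx a
  · exact hI.dcomm_mem a hx

theorem isIdeal_Gamma_succ {n : ℕ} (hI : IsIdeal A (Gamma A (n + 1))) :
    IsIdeal A (Gamma A (n + 2)) := by
  have hle := Gamma_succ_subset hI
  have hmul {x y : A} (hx : x ∈ Gamma A (n + 2)) (hy : y ∈ Gamma A (n + 2)) :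
      dmul x y ∈ Gamma A (n + 2) := .mul hx hy
  have hconj (a : A) {x : A} (hx : x ∈ Gamma A (n + 2)) :
      dmul (dmul a x) (dinv a) ∈ Gamma A (n + 2) := by
    rw [dconj_eq_dcomm_dmul]
    exact hmul (dcomm_mem_Gamma a (hle hx)) hx
  have hlam (a : A) {x : A} (hx : x ∈ Gamma A (n + 2)) : lam a x ∈ Gamma A (n + 2) := by
    rw [lam_eq_bstar_dmul]
    exact hmul (bstar_mem_Gamma_right a (hle hx)) hx
  refine ⟨.one, hmul, .inv, hconj, fun a x hx => ?_, hlam⟩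
  have hk := hI.cconj_mem a (hle hx)
  set k := cmul (cmul a x) (cinv a) with hk_def
  have h : dmul k (dmul (bstar k a) a) = dmul a (lam a x) := by
    rw [← cmul_eq_dmul_bstar, ← cmul_eq_dmul_lam, hk_def, cmul_conj_cmul]
  have hk_eq : k = dmul (dmul (dmul a (lam a x)) (dinv a)) (dinv (bstar k a)) := by
    simpa only [dinv_dmul_rev, dmul_assoc] using eq_dmul_dinv_of_dmul_eq h
  rw [hk_eq]
  exact hmul (hconj a (hlam a hx)) (.inv (bstar_mem_Gamma_left hk a))

theorem isIdeal_Gamma (A : Type u) [SkewBrace A] : ∀ n : ℕ, IsIdeal A (Gamma A n)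
  | 0 => isIdeal_univ
  | 1 => isIdeal_univ
  | n + 2 => isIdeal_Gamma_succ (isIdeal_Gamma A (n + 1))

theorem ccomm_mem_Gamma {n : ℕ} {x : A} (hx : x ∈ Gamma A (n + 1)) (a : A) :
    ccomm x a ∈ Gamma A (n + 2) := by
  have hJ := isIdeal_Gamma A (n + 2)
  have hc := (isIdeal_Gamma A (n + 1)).ccomm_mem hx a
  have h := ccomm_cmul x a
  generalize ccomm x a = c at hc h ⊢
  rw [cmul_eq_dmul_bstar c] at h
  have hu := bstar_mem_Gamma_left hc (cmul a x)
  generalize bstar c (cmul a x) = u at h hu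
  rw [cmul_eq_dmul_bstar a x, cmul_eq_dmul_bstar x a] at h
  have hc_eq : c = dmul (dmul (dmul (dmul (dmul x (bstar x a)) (dinv x)) (dcomm x a))
      (dmul (dmul a (dinv (bstar a x))) (dinv a))) (dinv u) := by
    rw [eq_dmul_dinv_of_dmul_eq h]
    simp only [dcomm, dinv_dmul_rev, dmul_assoc, dinv_dmul_cancel_left]
  rw [hc_eq, dcomm_swap]
  exact hJ.dmul_mem (hJ.dmul_mem (hJ.dmul_mem (hJ.dconj_mem x (bstar_mem_Gamma_left hx a))
    (hJ.dinv_mem (dcomm_mem_Gamma a hx)))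
    (hJ.dconj_mem a (hJ.dinv_mem (bstar_mem_Gamma_right a hx)))) (hJ.dinv_mem hu)

end

end SkewBrace

open SkewBrace in
/-- For every `n ≥ 1`, the `n`-th term of the lower central series of the group `(A,∘)`
is contained in the `n`-th term `Γ_n(A)` of the lower central series of the skew brace. -/
theorem gammaCirc_subset_Gamma (A : Type u) [SkewBrace A] (n : ℕ) (hn : 1 ≤ n) :
    gammaCirc A n ⊆ Gamma A n := by
  induction n, hn using Nat.le_induction with
  | base => exact Set.subset_univ _
  | succ n hn ih =>
    obtain ⟨n, rfl⟩ := Nat.exists_eq_add_of_le' hn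
    refine (isIdeal_Gamma A (n + 2)).ccl_subset ?_
    rintro _ ⟨x, hx, a, -, rfl⟩
    exact ccomm_mem_Gamma (ih hx) a
end

section
/- A skew left brace (A,·,∘) is symmetric (i.e., (A,∘,·) is also a skew left brace) if and only if λ_{a·b} = λ_{b∘a} for all a,b ∈ A. Moreover, in a symmetric skew brace, λ_{a⁻¹} = λ_{ā} = λ_a⁻¹ for all a ∈ A, where a⁻¹ is the inverse of a in (A,·) and ā is the inverse of a in (A,∘). -/
set_option linter.unusedVariables false

universe u v

namespace SkewBrace

variable {A : Type u} [SkewBrace A]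

theorem dmul_left_cancel {a b c : A} (h : dmul a b = dmul a c) : b = c := by
  rw [← dinv_dmul_cancel_left a b, h, dinv_dmul_cancel_left]

theorem dmul_lam (a b : A) : dmul a (lam a b) = cmul a b :=
  dmul_dinv_cancel_left a _

theorem lam_dmul (a b c : A) : lam a (dmul b c) = dmul (lam a b) (lam a c) := by
  simp only [lam, compat, dmul_assoc]

theorem lam_cmul (a b c : A) : lam (cmul a b) c = lam a (lam b c) := by
  apply dmul_left_cancel (a := cmul a b)
  rw [dmul_lam, ← dmul_lam a b, dmul_assoc, ← lam_dmul, dmul_lam, dmul_lam, dmul_lam, cmul_assoc]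

theorem lam_ident (b : A) : lam ident b = b := by
  rw [← ident_dmul (lam ident b), dmul_lam, ident_cmul]

theorem lam_cinv_lam (a b : A) : lam (cinv a) (lam a b) = b := by
  rw [← lam_cmul, cinv_cmul, lam_ident]

theorem lam_lam_cinv (a b : A) : lam a (lam (cinv a) b) = b := by
  rw [← lam_cmul, cmul_cinv, lam_ident]

theorem cinv_cmul_dmul (a b : A) : cmul (cinv a) (dmul a b) = lam (cinv a) b := by
  rw [compat, cinv_cmul, ident_dmul, lam]

/-- The compatibility relation of `(A,∘,·)` in terms of the lambda map of `(A,·,∘)`. -/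
theorem dmul_cmul_eq_iff (a b c : A) :
    dmul a (cmul b c) = cmul (cmul (dmul a b) (cinv a)) (dmul a c) ↔
      lam b c = lam (dmul a b) (lam (cinv a) c) := by
  rw [cmul_assoc, cinv_cmul_dmul, ← dmul_lam b c, ← dmul_assoc, ← dmul_lam (dmul a b)]
  exact ⟨dmul_left_cancel, congrArg _⟩

theorem isSymmetric_iff_lam_dmul :
    IsSymmetric A ↔ ∀ a b : A, lam (dmul a b) = lam (cmul b a) := by
  simp only [IsSymmetric, dmul_cmul_eq_iff]
  refine ⟨fun h a b => funext fun c => ?_, fun h a b c => ?_⟩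
  · rw [lam_cmul, h a b, lam_cinv_lam]
  · rw [h, lam_cmul, lam_lam_cinv]

theorem lam_dinv_eq_lam_cinv (h : IsSymmetric A) (a : A) : lam (dinv a) = lam (cinv a) := by
  funext b
  rw [← lam_lam_cinv a b, ← lam_cmul, ← isSymmetric_iff_lam_dmul.mp h, dmul_dinv, lam_ident,
    lam_lam_cinv]

end SkewBrace

open SkewBrace in
/-- A skew left brace `(A,·,∘)` is symmetric if and only if `λ_{a·b} = λ_{b∘a}` for all
`a, b ∈ A`. Moreover, in a symmetric skew brace, `λ_{a⁻¹} = λ_ā` and this map is a two-sided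
inverse of `λ_a`, for every `a ∈ A`. -/
theorem isSymmetric_iff_lam (A : Type u) [SkewBrace A] :
    (IsSymmetric A ↔ ∀ a b : A, lam (dmul a b) = lam (cmul b a)) ∧
    (IsSymmetric A → ∀ a : A,
      lam (dinv a) = lam (cinv a) ∧
      (∀ b : A, lam (dinv a) (lam a b) = b) ∧
      (∀ b : A, lam a (lam (dinv a) b) = b)) := by
  refine ⟨isSymmetric_iff_lam_dmul, fun h a => ?_⟩
  rw [lam_dinv_eq_lam_cinv h]
  exact ⟨rfl, lam_cinv_lam a, lam_lam_cinv a⟩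
end
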